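/- arXiv:1905.09254 — 2 statements merged into one kernel-verified Lean document; each statement's English description precedes it below -/
import Mathlib

section
/- Let E ∈ Gr′ᵏ. Then for every i with 1 ≤ i ≤ k, the subspace E ∩ V_{[k−i+1,N]} has dimension i; and for every i with k+1 ≤ i ≤ N−1, one has E ∩ V_{[N−i+k+1,N]} = 0, so that the subspace E + V_{[N−i+k+1,N]} has dimension i. (In particular the subspaces E′_1 ⊆ E′_2 ⊆ … ⊆ E′_{N−1} defined by E′_i = E ∩ V_{[k−i+1,N]} for i ∈ [1,k−1], E′_k = E, E′_i = E ⊕ V_{[N−i+k+1,N]} for i ∈ [k+1,N−1] form a complete flag with dim E′_i = i.) -/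
/-- `V_I`: the span of the standard basis vectors `e_i` for `i ∈ S`. -/
noncomputable def coordSubspace (N : ℕ) (S : Set (Fin N)) : Submodule ℝ (Fin N → ℝ) :=
  Submodule.span ℝ ((fun i => (Pi.single i 1 : Fin N → ℝ)) '' S)

theorem coordSubspace_mono {N : ℕ} {S T : Set (Fin N)} (h : S ⊆ T) :
    coordSubspace N S ≤ coordSubspace N T :=
  Submodule.span_mono (Set.image_mono h)

theorem finrank_coordSubspace {N : ℕ} (J : Finset (Fin N)) :
    Module.finrank ℝ (coordSubspace N ↑J) = J.card := by
  have hli : LinearIndependent ℝ (fun i : J => (Pi.single (i : Fin N) 1 : Fin N → ℝ)) :=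
    (Pi.linearIndependent_single_one (Fin N) ℝ).comp _ Subtype.val_injective
  have h := finrank_span_eq_card hli
  rw [Fintype.card_coe] at h
  rw [← h, coordSubspace, Set.image_eq_range]
  rfl

theorem inf_coordSubspace_eq_bot {N m : ℕ} {E : Submodule ℝ (Fin N → ℝ)} (hm : m ≤ N)
    (hgen : ∀ I : Finset (Fin N), I.card = m → E ⊓ coordSubspace N ↑I = ⊥)
    (J : Finset (Fin N)) (hJ : J.card ≤ m) : E ⊓ coordSubspace N ↑J = ⊥ := by
  obtain ⟨I, hJI, hI⟩ := Finset.exists_superset_card_eq hJ (by simpa using hm)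
  rw [eq_bot_iff, ← hgen I hI]
  exact inf_le_inf_left E (coordSubspace_mono (Finset.coe_subset.2 hJI))

theorem finrank_inf_coordSubspace {N k : ℕ} {E : Submodule ℝ (Fin N → ℝ)}
    (hk : k ≤ N) (hE : Module.finrank ℝ E = k)
    (hgen : ∀ I : Finset (Fin N), I.card = N - k → E ⊓ coordSubspace N ↑I = ⊥)
    (J : Finset (Fin N)) (hJ : N - k ≤ J.card) :
    Module.finrank ℝ ↥(E ⊓ coordSubspace N ↑J) + N = k + J.card := by
  obtain ⟨I, hIJ, hI⟩ := Finset.exists_subset_card_eq hJ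
  have hle := coordSubspace_mono (Finset.coe_subset.2 hIJ)
  have h₁ := Submodule.finrank_sup_add_finrank_inf_eq E (coordSubspace N ↑J)
  have h₂ := Submodule.finrank_sup_add_finrank_inf_eq
    (E ⊓ coordSubspace N ↑J) (coordSubspace N ↑I)
  rw [inf_assoc, inf_eq_right.2 hle, hgen I hI, finrank_bot, finrank_coordSubspace, hI] at h₂
  rw [hE, finrank_coordSubspace] at h₁
  have h₃ := Submodule.finrank_le (E ⊔ coordSubspace N ↑J)
  rw [Module.finrank_fin_fun] at h₃
  have h₄ := Submodule.finrank_mono (sup_le (inf_le_right (a := E)) hle)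
  rw [finrank_coordSubspace] at h₄
  omega

theorem card_filter_le_val (N a : ℕ) :
    (Finset.univ.filter fun j : Fin N => a ≤ (j : ℕ)).card = N - a := by
  have h : (Finset.univ.filter fun j : Fin N => a ≤ (j : ℕ)).map Fin.valEmbedding
      = Finset.Ico a N := by
    ext x
    simp only [Finset.mem_map, Finset.mem_filter, Finset.mem_univ, true_and,
      Fin.valEmbedding_apply, Finset.mem_Ico]
    exact ⟨by rintro ⟨j, hj, rfl⟩; exact ⟨hj, j.2⟩, fun hx => ⟨⟨x, hx.2⟩, hx.1, rfl⟩⟩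
  rw [← Finset.card_map Fin.valEmbedding, h, Nat.card_Ico]

/-- If `E ∈ Gr′ᵏ` (i.e. `E` is `k`-dimensional and `E ∩ V_I = 0` whenever `|I| = N - k`), then
`dim (E ∩ V_{[k-i+1,N]}) = i` for `1 ≤ i ≤ k`, and for `k+1 ≤ i ≤ N-1` one has
`E ∩ V_{[N-i+k+1,N]} = 0` and `dim (E + V_{[N-i+k+1,N]}) = i`.
Here the 1-indexed interval `[a,N]` corresponds to `{j : Fin N | a - 1 ≤ (j : ℕ)}`, so
`[k-i+1,N]` becomes `{j | k - i ≤ (j : ℕ)}` and `[N-i+k+1,N]` becomes `{j | N - i + k ≤ (j : ℕ)}`. -/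
theorem stmt3 (N k : ℕ) (hN : 2 ≤ N) (hk1 : 1 ≤ k) (hk2 : k ≤ N - 1)
    (E : Submodule ℝ (Fin N → ℝ)) (hE : Module.finrank ℝ E = k)
    (hgen : ∀ I : Finset (Fin N), I.card = N - k → E ⊓ coordSubspace N ↑I = ⊥) :
    (∀ i : ℕ, 1 ≤ i → i ≤ k →
      Module.finrank ℝ ↥(E ⊓ coordSubspace N {j : Fin N | k - i ≤ (j : ℕ)}) = i) ∧
    (∀ i : ℕ, k + 1 ≤ i → i ≤ N - 1 →
      E ⊓ coordSubspace N {j : Fin N | N - i + k ≤ (j : ℕ)} = ⊥ ∧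
      Module.finrank ℝ ↥(E ⊔ coordSubspace N {j : Fin N | N - i + k ≤ (j : ℕ)}) = i) := by
  have hset (a : ℕ) : {j : Fin N | a ≤ (j : ℕ)} =
      ↑(Finset.univ.filter fun j : Fin N => a ≤ (j : ℕ)) := by simp
  refine ⟨fun i hi1 hik => ?_, fun i hki hiN => ?_⟩
  · have hcard := card_filter_le_val N (k - i)
    have h := finrank_inf_coordSubspace (by omega) hE hgen _ (by rw [hcard]; omega)
    rw [hset]
    omega
  · have hcard := card_filter_le_val N (N - i + k)
    have hbot := inf_coordSubspace_eq_bot (Nat.sub_le N k) hgen _ (by rw [hcard]; omega)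
    rw [hset]
    refine ⟨hbot, ?_⟩
    have h := Submodule.finrank_sup_add_finrank_inf_eq E
      (coordSubspace N ↑(Finset.univ.filter fun j : Fin N => N - i + k ≤ (j : ℕ)))
    rw [hbot, finrank_bot, finrank_coordSubspace, hE, hcard] at h
    omega
end

section
/- The set P = {M : M is an N×k real matrix all of whose k×k minors are positive} is a connected component of the set G = {M : M is an N×k real matrix of rank k whose column span E is generic, i.e. satisfies (i) E ∩ V_{[1,N−k]} = 0, (ii) E ∩ V_{[k+1,N]} = 0, (iii) (E ∩ V_{[k−i+1,N]}) ∩ (E ∩ V_{[1,N−i]}) = 0 for all i ∈ [1,k−1], and (iv) (E + V_{[N−i+1,N]}) ∩ (E + V_{[1,N−k−i]}) = E for all i ∈ [1,N−k−1]}. (This is a matrix-level formulation of Theorem 0.5 together with 0.4(a): the totally positive Grassmannian Gr^k_{>0} = Gr′ᵏ_{>0} is a connected component of the generic set Gr^{k*}.) -/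
/-- The maximal (`k×k`) minor of an `N×k` matrix on the row set `I` (with `I.card = k`). -/
noncomputable def maxMinor {N k : ℕ} (M : Matrix (Fin N) (Fin k) ℝ)
    (I : Finset (Fin N)) (hI : I.card = k) : ℝ :=
  (M.submatrix (fun a => ((I.orderIsoOfFin hI a : I) : Fin N)) id).det

/-- The column span of an `N×k` matrix: the span of the `k` columns in `ℝ^N`. -/
noncomputable def colSpan {N k : ℕ} (M : Matrix (Fin N) (Fin k) ℝ) :
    Submodule ℝ (Fin N → ℝ) :=
  Submodule.span ℝ (Set.range M.transpose)

/-- `E` is generic (lies in `Gr^{k*}`): conditions (i)-(iv) of 0.4. The 1-indexed intervals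
`[1,m]` and `[a,N]` correspond to `{j : Fin N | (j : ℕ) < m}` and `{j : Fin N | a - 1 ≤ (j : ℕ)}`
respectively. -/
def IsGeneric (N k : ℕ) (E : Submodule ℝ (Fin N → ℝ)) : Prop :=
  E ⊓ coordSubspace N {j : Fin N | (j : ℕ) < N - k} = ⊥ ∧
  E ⊓ coordSubspace N {j : Fin N | k ≤ (j : ℕ)} = ⊥ ∧
  (∀ i : ℕ, 1 ≤ i → i ≤ k - 1 →
    (E ⊓ coordSubspace N {j : Fin N | k - i ≤ (j : ℕ)}) ⊓
      (E ⊓ coordSubspace N {j : Fin N | (j : ℕ) < N - i}) = ⊥) ∧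
  (∀ i : ℕ, 1 ≤ i → i ≤ N - k - 1 →
    (E ⊔ coordSubspace N {j : Fin N | N - i ≤ (j : ℕ)}) ⊓
      (E ⊔ coordSubspace N {j : Fin N | (j : ℕ) < N - k - i}) = E)

open Matrix Topology Filter

section Determinants

variable {n k m : ℕ}

/-- All maximal minors, taken with increasing row indices, are positive. -/
def IsTotallyPositive (M : Matrix (Fin n) (Fin k) ℝ) : Prop :=
  ∀ g : Fin k → Fin n, StrictMono g → 0 < (M.submatrix g id).det

/-- All maximal minors, taken with increasing row indices, are nonnegative. -/
def IsTotallyNonneg (M : Matrix (Fin n) (Fin k) ℝ) : Prop :=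
  ∀ g : Fin k → Fin n, StrictMono g → 0 ≤ (M.submatrix g id).det

theorem strictMono_comp_sort {f : Fin k → Fin n} (hf : Function.Injective f) :
    StrictMono (f ∘ Tuple.sort f) :=
  (Tuple.monotone_sort f).strictMono_of_injective (hf.comp (Equiv.injective _))

theorem injective_of_det_submatrix_ne_zero {M : Matrix (Fin n) (Fin k) ℝ} {f : Fin k → Fin n}
    (h : (M.submatrix f id).det ≠ 0) : Function.Injective f := by
  intro i j hij
  by_contra hne
  exact h (det_zero_of_row_eq hne (by ext l; simp [hij]))

/-- The Vandermonde determinant of a selection of row indices; it records the sign of the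
permutation sorting them. -/
noncomputable def indexVandermonde (f : Fin k → Fin n) : ℝ :=
  (vandermonde fun i => ((f i : ℕ) : ℝ)).det

theorem indexVandermonde_pos {f : Fin k → Fin n} (hf : StrictMono f) :
    0 < indexVandermonde f := by
  rw [indexVandermonde, det_vandermonde]
  refine Finset.prod_pos fun i _ => Finset.prod_pos fun j hj => ?_
  have : (f i : ℕ) < f j := hf (Finset.mem_Ioi.1 hj)
  exact sub_pos.2 (by exact_mod_cast this)

theorem indexVandermonde_ne_zero {f : Fin k → Fin n} (hf : Function.Injective f) :
    indexVandermonde f ≠ 0 := by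
  rw [indexVandermonde, det_vandermonde_ne_zero_iff]
  intro i j hij
  exact hf (Fin.ext (Nat.cast_injective (R := ℝ) hij))

theorem det_submatrix_comp_mul_indexVandermonde (M : Matrix (Fin n) (Fin k) ℝ)
    (f : Fin k → Fin n) (σ : Equiv.Perm (Fin k)) :
    (M.submatrix (f ∘ σ) id).det * indexVandermonde (f ∘ σ) =
      (M.submatrix f id).det * indexVandermonde f := by
  change ((M.submatrix f id).submatrix σ id).det *
    ((vandermonde fun i => ((f i : ℕ) : ℝ)).submatrix σ id).det = _
  rw [det_permute, det_permute, indexVandermonde, mul_mul_mul_comm, ← Int.cast_mul,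
    ← Units.val_mul, Int.units_mul_self]
  simp

theorem IsTotallyPositive.det_mul_indexVandermonde_pos {M : Matrix (Fin n) (Fin k) ℝ}
    (hM : IsTotallyPositive M) {f : Fin k → Fin n} (hf : Function.Injective f) :
    0 < (M.submatrix f id).det * indexVandermonde f := by
  rw [← det_submatrix_comp_mul_indexVandermonde M f (Tuple.sort f)]
  exact mul_pos (hM _ (strictMono_comp_sort hf)) (indexVandermonde_pos (strictMono_comp_sort hf))

theorem IsTotallyNonneg.det_mul_indexVandermonde_nonneg {M : Matrix (Fin n) (Fin k) ℝ}
    (hM : IsTotallyNonneg M) (f : Fin k → Fin n) :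
    0 ≤ (M.submatrix f id).det * indexVandermonde f := by
  by_cases h : (M.submatrix f id).det = 0
  · simp [h]
  have hf := injective_of_det_submatrix_ne_zero h
  rw [← det_submatrix_comp_mul_indexVandermonde M f (Tuple.sort f)]
  exact mul_nonneg (hM _ (strictMono_comp_sort hf))
    (indexVandermonde_pos (strictMono_comp_sort hf)).le

theorem det_submatrix_ne_zero_of_range_eq {M : Matrix (Fin n) (Fin k) ℝ} {f g : Fin k → Fin n}
    (hf : (M.submatrix f id).det ≠ 0) (hg : Function.Injective g)
    (h : Set.range f = Set.range g) : (M.submatrix g id).det ≠ 0 := by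
  have hfi := injective_of_det_submatrix_ne_zero hf
  have hfg : f ∘ Tuple.sort f = g ∘ Tuple.sort g := by
    refine ((strictMono_comp_sort hfi).range_inj (strictMono_comp_sort hg)).1 ?_
    rw [(Tuple.sort f).surjective.range_comp, (Tuple.sort g).surjective.range_comp, h]
  have h1 := det_submatrix_comp_mul_indexVandermonde M f (Tuple.sort f)
  rw [hfg, det_submatrix_comp_mul_indexVandermonde] at h1
  intro h0
  rw [h0, zero_mul] at h1
  exact mul_ne_zero hf (indexVandermonde_ne_zero hfi) h1.symm

/-- Three-term Grassmann–Plücker relation. -/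
theorem det_cons_cons_mul_det_cons_cons (e : Fin m → Fin (m + 2) → ℝ)
    (a b c d : Fin (m + 2) → ℝ) :
    (of (Fin.cons a (Fin.cons c e) : Fin (m + 2) → Fin (m + 2) → ℝ)).det *
        (of (Fin.cons b (Fin.cons d e) : Fin (m + 2) → Fin (m + 2) → ℝ)).det =
      (of (Fin.cons a (Fin.cons b e) : Fin (m + 2) → Fin (m + 2) → ℝ)).det *
        (of (Fin.cons c (Fin.cons d e) : Fin (m + 2) → Fin (m + 2) → ℝ)).det +
      (of (Fin.cons a (Fin.cons d e) : Fin (m + 2) → Fin (m + 2) → ℝ)).det *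
        (of (Fin.cons b (Fin.cons c e) : Fin (m + 2) → Fin (m + 2) → ℝ)).det := by
  set D : (Fin (m + 2) → ℝ) → (Fin (m + 2) → ℝ) → ℝ := fun x y =>
    (of (Fin.cons x (Fin.cons y e) : Fin (m + 2) → Fin (m + 2) → ℝ)).det with hD
  change D a c * D b d = D a b * D c d + D a d * D b c
  have hswap : D c b = - D b c := by
    have h := det_permute (Equiv.swap (0 : Fin (m + 2)) 1)
      (of (Fin.cons b (Fin.cons c e) : Fin (m + 2) → Fin (m + 2) → ℝ))
    rw [Equiv.Perm.sign_swap (by simp)] at h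
    have h2 : (of (Fin.cons b (Fin.cons c e) : Fin (m + 2) → Fin (m + 2) → ℝ)).submatrix
        (Equiv.swap (0 : Fin (m + 2)) 1) id =
        of (Fin.cons c (Fin.cons b e) : Fin (m + 2) → Fin (m + 2) → ℝ) := by
      ext i j
      refine Fin.cases ?_ (fun i => ?_) i
      · simp
      · refine Fin.cases ?_ (fun i => ?_) i
        · simp
        · have h3 : Equiv.swap (0 : Fin (m + 2)) 1 i.succ.succ = i.succ.succ :=
            Equiv.swap_apply_of_ne_of_ne (Fin.succ_ne_zero _)
              (by rw [← Fin.succ_zero_eq_one]; simp [Fin.ext_iff])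
          simp [h3]
    rw [h2] at h
    simpa [hD] using h
  set A : Matrix (Fin (m + 2)) (Fin (m + 2)) ℝ := of (Fin.cons a (Fin.cons b e)) with hA
  set B : Matrix (Fin (m + 2)) (Fin (m + 2)) ℝ := of (Fin.cons 0 (Fin.cons d e)) with hB
  have hL : ∀ x, cramer Bᵀ x 0 = D x d := by
    intro x
    rw [cramer_transpose_apply, hD]
    congr 1
    ext i j
    refine Fin.cases ?_ (fun i => ?_) i <;> simp [hB, updateRow_apply]
  have hc : ∑ i, cramer Aᵀ c i • A i = A.det • c := by
    have h := mulVec_cramer Aᵀ c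
    rw [det_transpose] at h
    rw [← h]
    ext j
    simp [mulVec, dotProduct, Finset.sum_apply, mul_comm]
  have h0 : cramer Aᵀ c 0 = D c b := by
    rw [cramer_transpose_apply, hD]
    congr 1
    ext i j
    refine Fin.cases ?_ (fun i => ?_) i <;> simp [hA, updateRow_apply]
  have h1 : cramer Aᵀ c 1 = D a c := by
    rw [cramer_transpose_apply, hD]
    congr 1
    ext i j
    refine Fin.cases ?_ (fun i => ?_) i
    · simp [hA, updateRow_apply]
    · refine Fin.cases ?_ (fun i => ?_) i <;> simp [hA, updateRow_apply, Fin.ext_iff]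
  have he : ∀ i, D (e i) d = 0 := fun i =>
    det_zero_of_row_eq (i := 0) (j := i.succ.succ) (Fin.succ_ne_zero _).symm rfl
  have h2 := congrArg (fun x => cramer Bᵀ x 0) hc
  beta_reduce at h2
  rw [map_sum, map_smul, Finset.sum_apply, Pi.smul_apply, hL, smul_eq_mul] at h2
  replace h2 : ∑ i, cramer Aᵀ c i * D (A i) d = A.det * D c d := by
    rw [← h2]
    exact Finset.sum_congr rfl fun i _ => by rw [map_smul, Pi.smul_apply, hL, smul_eq_mul]
  rw [Fin.sum_univ_succ, Fin.sum_univ_succ, Fin.succ_zero_eq_one, h0, h1] at h2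
  have h3 : ∑ i : Fin m, cramer Aᵀ c i.succ.succ * D (A i.succ.succ) d = 0 :=
    Finset.sum_eq_zero fun i _ => by
      rw [show A i.succ.succ = e i from rfl, he, mul_zero]
  rw [h3, show A 0 = a from rfl, show A 1 = b from rfl, show A.det = D a b from rfl, hswap] at h2
  linarith

theorem indexVandermonde_cons_cons (e : Fin m → Fin n) (x y : Fin n) :
    indexVandermonde (Fin.cons x (Fin.cons y e) : Fin (m + 2) → Fin n) =
      (((y : ℕ) : ℝ) - (x : ℕ)) * (∏ j, (((e j : ℕ) : ℝ) - (x : ℕ))) *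
        (∏ j, (((e j : ℕ) : ℝ) - (y : ℕ))) * indexVandermonde e := by
  simp only [indexVandermonde, det_vandermonde]
  rw [Fin.prod_univ_succ, Fin.prod_univ_succ]
  simp only [Fin.prod_Ioi_zero, Fin.prod_Ioi_succ, Fin.cons_zero, Fin.cons_succ,
    Fin.prod_univ_succ]
  ring

/-- For a totally nonnegative matrix, the nonvanishing of the minors attached to two disjoint
noncrossing pairs forces the nonvanishing of the minors attached to the crossing pairs. -/
theorem IsTotallyNonneg.det_cons_cons_ne_zero {M : Matrix (Fin n) (Fin (m + 2)) ℝ}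
    (hM : IsTotallyNonneg M) (e : Fin m → Fin n) {a b c d : Fin n}
    (hab : a < b) (hbc : b < c) (hcd : c < d)
    (h : (M.submatrix (Fin.cons a (Fin.cons b e) : Fin (m + 2) → Fin n) id).det ≠ 0 ∧
          (M.submatrix (Fin.cons c (Fin.cons d e) : Fin (m + 2) → Fin n) id).det ≠ 0 ∨
        (M.submatrix (Fin.cons a (Fin.cons d e) : Fin (m + 2) → Fin n) id).det ≠ 0 ∧
          (M.submatrix (Fin.cons b (Fin.cons c e) : Fin (m + 2) → Fin n) id).det ≠ 0) :
    (M.submatrix (Fin.cons a (Fin.cons c e) : Fin (m + 2) → Fin n) id).det ≠ 0 ∧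
      (M.submatrix (Fin.cons b (Fin.cons d e) : Fin (m + 2) → Fin n) id).det ≠ 0 := by
  set p : Fin n → Fin n → ℝ := fun x y =>
    (M.submatrix (Fin.cons x (Fin.cons y e) : Fin (m + 2) → Fin n) id).det with hp
  change p a b ≠ 0 ∧ p c d ≠ 0 ∨ p a d ≠ 0 ∧ p b c ≠ 0 at h
  change p a c ≠ 0 ∧ p b d ≠ 0
  have hpl : p a c * p b d = p a b * p c d + p a d * p b c := by
    have hrow : ∀ x y, p x y = (of (Fin.cons (M x) (Fin.cons (M y) fun j => M (e j)) :
        Fin (m + 2) → Fin (m + 2) → ℝ)).det := by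
      intro x y
      refine congrArg det ?_
      ext i j
      refine Fin.cases ?_ (fun i => Fin.cases ?_ (fun i => ?_) i) i <;> simp
    simp only [hrow]
    exact det_cons_cons_mul_det_cons_cons _ _ _ _ _
  set w : Fin n → Fin n → ℝ := fun x y =>
    indexVandermonde (Fin.cons x (Fin.cons y e) : Fin (m + 2) → Fin n) with hw
  have hpw : ∀ x y, 0 ≤ p x y * w x y := fun x y => hM.det_mul_indexVandermonde_nonneg _
  have hw0 : ∀ {x y}, p x y ≠ 0 → w x y ≠ 0 := fun hxy =>
    indexVandermonde_ne_zero (injective_of_det_submatrix_ne_zero hxy)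
  have hlt : ∀ {x y : Fin n}, x < y → 0 < ((y : ℕ) : ℝ) - (x : ℕ) := fun {x y} hxy =>
    sub_pos.2 (by exact_mod_cast hxy)
  obtain ⟨K, hK⟩ : ∃ K : ℝ, w a b * w c d =
        K * ((((b : ℕ) : ℝ) - (a : ℕ)) * (((d : ℕ) : ℝ) - (c : ℕ))) ∧
      w a d * w b c = K * ((((d : ℕ) : ℝ) - (a : ℕ)) * (((c : ℕ) : ℝ) - (b : ℕ))) := by
    refine ⟨(∏ j, (((e j : ℕ) : ℝ) - (a : ℕ))) * (∏ j, (((e j : ℕ) : ℝ) - (b : ℕ))) *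
      (∏ j, (((e j : ℕ) : ℝ) - (c : ℕ))) * (∏ j, (((e j : ℕ) : ℝ) - (d : ℕ))) *
      indexVandermonde e ^ 2, ?_, ?_⟩ <;>
    · simp only [hw, indexVandermonde_cons_cons]
      ring
  have q1 : 0 < (((b : ℕ) : ℝ) - (a : ℕ)) * (((d : ℕ) : ℝ) - (c : ℕ)) :=
    mul_pos (hlt hab) (hlt hcd)
  have q2 : 0 < (((d : ℕ) : ℝ) - (a : ℕ)) * (((c : ℕ) : ℝ) - (b : ℕ)) :=
    mul_pos (hlt (hab.trans (hbc.trans hcd))) (hlt hbc)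
  have r1 : 0 ≤ p a b * p c d * K := by
    refine nonneg_of_mul_nonneg_left ?_ q1
    rw [mul_assoc, ← hK.1, mul_mul_mul_comm]
    exact mul_nonneg (hpw _ _) (hpw _ _)
  have r2 : 0 ≤ p a d * p b c * K := by
    refine nonneg_of_mul_nonneg_left ?_ q2
    rw [mul_assoc, ← hK.2, mul_mul_mul_comm]
    exact mul_nonneg (hpw _ _) (hpw _ _)
  have hpos : 0 < p a b * p c d * K + p a d * p b c * K := by
    rcases h with ⟨h1, h2⟩ | ⟨h1, h2⟩
    · have hK0 : K ≠ 0 := left_ne_zero_of_mul (hK.1 ▸ mul_ne_zero (hw0 h1) (hw0 h2))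
      exact add_pos_of_pos_of_nonneg
        (r1.lt_of_ne' (mul_ne_zero (mul_ne_zero h1 h2) hK0)) r2
    · have hK0 : K ≠ 0 := left_ne_zero_of_mul (hK.2 ▸ mul_ne_zero (hw0 h1) (hw0 h2))
      exact add_pos_of_nonneg_of_pos r1
        (r2.lt_of_ne' (mul_ne_zero (mul_ne_zero h1 h2) hK0))
  rw [← add_mul, ← hpl] at hpos
  exact mul_ne_zero_iff.1 (left_ne_zero_of_mul hpos.ne')

end Determinants

section CyclicIntervals

/-- The cyclic interval of length `k` starting at `s` in `{0, …, n - 1}`. -/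
def cyclicInterval (n k s : ℕ) : Finset ℕ :=
  (Finset.range n).filter fun x => (s ≤ x ∧ x < s + k) ∨ x + n < s + k

theorem mem_cyclicInterval {n k s x : ℕ} :
    x ∈ cyclicInterval n k s ↔ x < n ∧ ((s ≤ x ∧ x < s + k) ∨ x + n < s + k) := by
  simp [cyclicInterval]

/-- `B` is closed under passing from noncrossing to crossing pairs inside `{0, …, n - 1}`. -/
def CrossingClosed (n k : ℕ) (B : Finset ℕ → Prop) : Prop :=
  ∀ (S : Finset ℕ) (a b c d : ℕ), S ⊆ Finset.range n → S.card + 2 = k →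
    a < b → b < c → c < d → d < n → a ∉ S → b ∉ S → c ∉ S → d ∉ S →
    (B (insert a (insert b S)) ∧ B (insert c (insert d S)) ∨
      B (insert a (insert d S)) ∧ B (insert b (insert c S))) →
    B (insert a (insert c S)) ∧ B (insert b (insert d S))

theorem CrossingClosed.of_succ {n k : ℕ} {B : Finset ℕ → Prop}
    (h : CrossingClosed (n + 1) k B) : CrossingClosed n k B :=
  fun S a b c d hS hk hab hbc hcd hd =>
    h S a b c d (hS.trans (Finset.range_mono n.le_succ)) hk hab hbc hcd (hd.trans n.lt_succ_self)

theorem card_filter_lt_or_le {n p q : ℕ} (hpq : p ≤ q) (hq : q ≤ n) :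
    ((Finset.range n).filter fun x => x < p ∨ q ≤ x).card = p + (n - q) := by
  have h : (Finset.range n).filter (fun x => x < p ∨ q ≤ x) =
      Finset.range p ∪ Finset.Ico q n := by
    ext x; simp only [Finset.mem_filter, Finset.mem_range, Finset.mem_union, Finset.mem_Ico]
    omega
  rw [h, Finset.card_union_of_disjoint]
  · simp
  · rw [Finset.disjoint_left]
    intro x; simp only [Finset.mem_range, Finset.mem_Ico]; omega

theorem CrossingClosed.cyclicInterval_of_succ {n k : ℕ} {B : Finset ℕ → Prop} (hk : 1 ≤ k)
    (hkn : k ≤ n) (h : CrossingClosed (n + 1) k B)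
    (hB : ∀ s < n + 1, B (cyclicInterval (n + 1) k s)) (s : ℕ) (hs : s < n) :
    B (cyclicInterval n k s) := by
  have key : ∀ i < k, B ((Finset.range n).filter fun x => x < k - i ∨ n - i ≤ x) := by
    intro i
    induction i with
    | zero =>
      intro _
      convert hB 0 (by omega) using 1
      ext x; simp only [cyclicInterval, Finset.mem_filter, Finset.mem_range]; omega
    | succ i ih =>
      intro hi
      rcases hkn.eq_or_lt with rfl | hlt
      · convert hB 0 (by omega) using 1
        ext x; simp only [cyclicInterval, Finset.mem_filter, Finset.mem_range]; omega
      have := (h ((Finset.range n).filter fun x => x < k - i - 2 ∨ n - i ≤ x)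
        (k - i - 2) (k - i - 1) (n - i - 1) n ?_ ?_ (by omega) (by omega) (by omega) (by omega)
        ?_ ?_ ?_ ?_ (Or.inl ⟨?_, ?_⟩)).1
      · convert this using 1
        ext x; simp only [Finset.mem_filter, Finset.mem_range, Finset.mem_insert]; omega
      · intro x; simp only [Finset.mem_filter, Finset.mem_range]; omega
      · rw [card_filter_lt_or_le (by omega) (by omega)]; omega
      · simp only [Finset.mem_filter, Finset.mem_range]; omega
      · simp only [Finset.mem_filter, Finset.mem_range]; omega
      · simp only [Finset.mem_filter, Finset.mem_range]; omega
      · simp only [Finset.mem_filter, Finset.mem_range]; omega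
      · convert ih (by omega) using 1
        ext x; simp only [Finset.mem_filter, Finset.mem_range, Finset.mem_insert]; omega
      · convert hB (n - i - 1) (by omega) using 1
        ext x
        simp only [cyclicInterval, Finset.mem_filter, Finset.mem_range, Finset.mem_insert]
        omega
  by_cases hsk : s + k ≤ n
  · convert hB s (by omega) using 1
    ext x; simp only [cyclicInterval, Finset.mem_filter, Finset.mem_range]; omega
  · convert key (n - s) (by omega) using 1
    ext x; simp only [cyclicInterval, Finset.mem_filter, Finset.mem_range]; omega

/-- The rotation `x ↦ x - 1` of `{0, …, n}`, extended by the identity. -/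
def rotateDown (n : ℕ) : ℕ ↪ ℕ where
  toFun x := if x = 0 then n else if x ≤ n then x - 1 else x
  inj' x y h := by
    simp only at h
    split_ifs at h <;> omega

theorem rotateDown_apply (n x : ℕ) :
    rotateDown n x = if x = 0 then n else if x ≤ n then x - 1 else x := rfl

theorem rotateDown_zero (n : ℕ) : rotateDown n 0 = n := rfl

theorem rotateDown_of_pos {n x : ℕ} (h0 : 0 < x) (hx : x ≤ n) : rotateDown n x = x - 1 := by
  simp [rotateDown_apply, h0.ne', hx]

theorem rotateDown_lt {n x : ℕ} (hx : x < n + 1) : rotateDown n x < n + 1 := by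
  simp only [rotateDown_apply]
  split_ifs <;> omega

theorem rotateDown_add_one {n x : ℕ} (hx : x < n + 1) :
    rotateDown n (if x = n then 0 else x + 1) = x := by
  split_ifs with h
  · exact h.symm
  · rw [rotateDown_of_pos x.succ_pos (by omega), Nat.succ_sub_one]

theorem mem_map_rotateDown {n x : ℕ} (S : Finset ℕ) (hx : x < n + 1) :
    x ∈ S.map (rotateDown n) ↔ (if x = n then 0 else x + 1) ∈ S := by
  conv_lhs => rw [← rotateDown_add_one hx]
  exact Finset.mem_map' _

theorem map_rotateDown_subset {n : ℕ} {S : Finset ℕ} (hS : S ⊆ Finset.range (n + 1)) :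
    S.map (rotateDown n) ⊆ Finset.range (n + 1) := by
  intro x hx
  obtain ⟨y, hy, rfl⟩ := Finset.mem_map.1 hx
  exact Finset.mem_range.2 (rotateDown_lt (Finset.mem_range.1 (hS hy)))

theorem CrossingClosed.rotate {n k : ℕ} {B : Finset ℕ → Prop}
    (h : CrossingClosed (n + 1) k B) :
    CrossingClosed (n + 1) k fun S => B (S.map (rotateDown n)) := by
  intro S a b c d hS hk hab hbc hcd hd ha hb hc hd' hyp
  simp only [Finset.map_insert] at hyp ⊢
  have hmem : ∀ x, x ∉ S → rotateDown n x ∉ S.map (rotateDown n) := fun x hx => by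
    rwa [Finset.mem_map']
  have ha := hmem a ha
  have hb := hmem b hb
  have hc := hmem c hc
  have hd' := hmem d hd'
  have hcard : (S.map (rotateDown n)).card + 2 = k := by rwa [Finset.card_map]
  have hS' := map_rotateDown_subset hS
  rw [rotateDown_of_pos (by omega : 0 < b) (by omega)] at *
  rw [rotateDown_of_pos (by omega : 0 < c) (by omega)] at *
  rw [rotateDown_of_pos (by omega : 0 < d) (by omega)] at *
  rcases Nat.eq_zero_or_pos a with rfl | ha0
  · rw [rotateDown_zero] at *
    have := h _ (b - 1) (c - 1) (d - 1) n hS' hcard (by omega) (by omega) (by omega) (by omega)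
      hb hc hd' ha (by
        rcases hyp with ⟨h1, h2⟩ | ⟨h1, h2⟩
        · right
          rw [Finset.insert_comm]
          exact ⟨h1, h2⟩
        · left
          rw [Finset.insert_comm (d - 1)]
          exact ⟨h2, h1⟩)
    rw [Finset.insert_comm (c - 1)] at this
    exact this.symm
  · rw [rotateDown_of_pos ha0 (by omega)] at *
    exact h _ (a - 1) (b - 1) (c - 1) (d - 1) hS' hcard (by omega) (by omega) (by omega)
      (by omega) ha hb hc hd' hyp

theorem map_rotateDown_cyclicInterval {n k s : ℕ} (hk : k ≤ n) (hs : s < n + 1) :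
    (cyclicInterval (n + 1) k s).map (rotateDown n) =
      cyclicInterval (n + 1) k (rotateDown n s) := by
  ext x
  by_cases hx : x < n + 1
  · rw [mem_map_rotateDown _ hx]
    simp only [mem_cyclicInterval, rotateDown_apply]
    split_ifs <;> omega
  · refine iff_of_false (fun h => hx ?_) (fun h => hx ?_)
    · exact Finset.mem_range.1 (map_rotateDown_subset (Finset.filter_subset _ _) h)
    · exact Finset.mem_range.1 (Finset.filter_subset _ _ h)

/-- A crossing-closed family containing all cyclic intervals of length `k` contains all subsets
of cardinality `k`. -/
theorem CrossingClosed.of_cyclicInterval {n k : ℕ} (hk : 1 ≤ k) (hkn : k ≤ n)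
    {B : Finset ℕ → Prop} (h : CrossingClosed n k B)
    (hB : ∀ s < n, B (cyclicInterval n k s)) {J : Finset ℕ} (hJ : J ⊆ Finset.range n)
    (hJk : J.card = k) : B J := by
  induction n, hkn using Nat.le_induction generalizing B J with
  | base =>
    have hJ' : J = Finset.range k := Finset.eq_of_subset_of_card_le hJ (by simp [hJk])
    convert hB 0 hk using 1
    rw [hJ']
    ext x; simp only [cyclicInterval, Finset.mem_filter, Finset.mem_range]; omega
  | succ n hkn ih =>
    have key : ∀ i : ℕ, ∀ (B : Finset ℕ → Prop) (J : Finset ℕ), CrossingClosed (n + 1) k B →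
        (∀ s < n + 1, B (cyclicInterval (n + 1) k s)) → J ⊆ Finset.range (n + 1) →
        J.card = k → i ≤ n → n - i ∉ J → B J := by
      intro i
      induction i with
      | zero =>
        intro B J h hB hJ hJk _ hn
        refine ih h.of_succ (h.cyclicInterval_of_succ hk hkn hB) ?_ hJk
        intro x hx
        have h1 := Finset.mem_range.1 (hJ hx)
        have h2 : x ≠ n := by rintro rfl; exact hn hx
        exact Finset.mem_range.2 (by omega)
      | succ i ihi =>
        intro B J h hB hJ hJk hi hmem
        set J' := (Finset.range (n + 1)).filter fun x => rotateDown n x ∈ J with hJ'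
        have hmap : J'.map (rotateDown n) = J := by
          ext x
          by_cases hx : x < n + 1
          · rw [mem_map_rotateDown _ hx, hJ', Finset.mem_filter, Finset.mem_range]
            rw [rotateDown_add_one hx]
            refine and_iff_right ?_
            split_ifs <;> omega
          · refine iff_of_false (fun h => hx ?_) fun h => hx (Finset.mem_range.1 (hJ h))
            exact Finset.mem_range.1 (map_rotateDown_subset (Finset.filter_subset _ _) h)
        have := ihi (fun S => B (S.map (rotateDown n))) J' h.rotate
          (fun s hs => by
            simp only [map_rotateDown_cyclicInterval hkn hs]
            exact hB _ (rotateDown_lt hs))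
          (Finset.filter_subset _ _) (by rw [← Finset.card_map (rotateDown n), hmap, hJk])
          (by omega) (by
            rw [hJ', Finset.mem_filter, rotateDown_of_pos (by omega) (by omega)]
            rintro ⟨-, h1⟩
            exact hmem (by rwa [show n - (i + 1) = n - i - 1 by omega]))
        simpa only [hmap] using this
    obtain ⟨j, hj, hjJ⟩ : ∃ j ∈ Finset.range (n + 1), j ∉ J := by
      by_contra! hcon
      have := Finset.card_le_card hcon
      rw [Finset.card_range] at this
      omega
    rw [Finset.mem_range] at hj
    exact key (n - j) B J h hB hJ hJk (by omega) (by rwa [show n - (n - j) = j by omega])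

end CyclicIntervals

section Connectedness

theorem IsOpen.isPreconnected_of_fst_fibers {X Y : Type*} [TopologicalSpace X]
    [TopologicalSpace Y] {R : Set (X × Y)} (hR : IsOpen R)
    (hbase : IsPreconnected (Prod.fst '' R))
    (hfib : ∀ x ∈ Prod.fst '' R, IsPreconnected {y | (x, y) ∈ R}) : IsPreconnected R := by
  intro U V hU hV hUV hRU hRV
  have hcover : Prod.fst '' R ⊆ Prod.fst '' (R ∩ U) ∪ Prod.fst '' (R ∩ V) := by
    rw [← Set.image_union, ← Set.inter_union_distrib_left, Set.inter_eq_left.2 hUV]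
  obtain ⟨x, hx, ⟨⟨_, y₁⟩, ⟨h₁, h₁U⟩, rfl⟩, ⟨⟨x, y₂⟩, ⟨h₂, h₂V⟩, rfl⟩⟩ :=
    hbase _ _ (isOpenMap_fst _ (hR.inter hU)) (isOpenMap_fst _ (hR.inter hV)) hcover
      ((hRU.image Prod.fst).mono fun _ h => ⟨Set.image_mono Set.inter_subset_left h, h⟩)
      ((hRV.image Prod.fst).mono fun _ h => ⟨Set.image_mono Set.inter_subset_left h, h⟩)
  have hc : Continuous fun y : Y => (x, y) := by fun_prop
  obtain ⟨y, hy, hyU, hyV⟩ := hfib x hx _ _ (hU.preimage hc) (hV.preimage hc)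
    (fun y hy => hUV hy) ⟨y₁, h₁, h₁U⟩ ⟨y₂, h₂, h₂V⟩
  exact ⟨(x, y), hy, hyU, hyV⟩

variable {n k m : ℕ}

/-- The matrix obtained by adding a first row. -/
def consRow (r : Fin k → ℝ) (M : Matrix (Fin n) (Fin k) ℝ) : Matrix (Fin (n + 1)) (Fin k) ℝ :=
  of (Fin.cons r M)

theorem consRow_zero (r : Fin k → ℝ) (M : Matrix (Fin n) (Fin k) ℝ) : consRow r M 0 = r := rfl

theorem consRow_succ (r : Fin k → ℝ) (M : Matrix (Fin n) (Fin k) ℝ) (i : Fin n) :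
    consRow r M i.succ = M i := rfl

theorem consRow_tail (M : Matrix (Fin (n + 1)) (Fin k) ℝ) :
    consRow (M 0) (M.submatrix Fin.succ id) = M := by
  ext i j
  refine Fin.cases ?_ (fun i => ?_) i <;> rfl

theorem continuous_consRow :
    Continuous fun p : Matrix (Fin n) (Fin k) ℝ × (Fin k → ℝ) => consRow p.2 p.1 :=
  Continuous.finCons (A := fun _ => Fin k → ℝ) continuous_snd continuous_fst

theorem IsOpen.isPreconnected_of_consRow {Q : Set (Matrix (Fin n) (Fin k) ℝ)}
    {P : Set (Matrix (Fin (n + 1)) (Fin k) ℝ)} (hP : IsOpen P) (hQ : IsPreconnected Q)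
    (htail : ∀ r M, consRow r M ∈ P → M ∈ Q) (hne : ∀ M ∈ Q, ∃ r, consRow r M ∈ P)
    (hfib : ∀ M ∈ Q, IsPreconnected {r | consRow r M ∈ P}) : IsPreconnected P := by
  set Φ := fun p : Matrix (Fin n) (Fin k) ℝ × (Fin k → ℝ) => consRow p.2 p.1
  have hbase : Prod.fst '' (Φ ⁻¹' P) = Q := by
    ext M
    constructor
    · rintro ⟨⟨M, r⟩, h, rfl⟩
      exact htail _ _ h
    · intro hM
      obtain ⟨r, hr⟩ := hne M hM
      exact ⟨(M, r), hr, rfl⟩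
  have h : IsPreconnected (Φ ⁻¹' P) :=
    (hP.preimage continuous_consRow).isPreconnected_of_fst_fibers (hbase ▸ hQ)
      (by rw [hbase]; exact hfib)
  have hsurj : Function.Surjective Φ := fun M => ⟨(M.submatrix Fin.succ id, M 0), consRow_tail M⟩
  rw [← Set.image_preimage_eq P hsurj]
  exact h.image _ continuous_consRow.continuousOn

theorem det_consRow_submatrix_affine (M : Matrix (Fin n) (Fin k) ℝ) {g : Fin k → Fin (n + 1)}
    (hg : Function.Injective g) (r s : Fin k → ℝ) {a b : ℝ} (hab : a + b = 1) :
    ((consRow (a • r + b • s) M).submatrix g id).det =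
      a * ((consRow r M).submatrix g id).det + b * ((consRow s M).submatrix g id).det := by
  by_cases h : ∃ i, g i = 0
  · obtain ⟨i, hi⟩ := h
    have key : ∀ r, (consRow r M).submatrix g id =
        updateRow ((consRow 0 M).submatrix g id) i r := by
      intro r
      ext j l
      by_cases hj : j = i
      · subst hj
        simp [hi, consRow_zero]
      · have hgj : g j ≠ 0 := fun h0 => hj (hg (h0.trans hi.symm))
        obtain ⟨x, hx⟩ := Fin.exists_succ_eq.2 hgj
        simp [updateRow_ne hj, ← hx, consRow_succ]
    rw [key, key r, key s, det_updateRow_add, det_updateRow_smul, det_updateRow_smul]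
  · push Not at h
    have key : ∀ r, (consRow r M).submatrix g id = (consRow 0 M).submatrix g id := by
      intro r
      ext j l
      obtain ⟨x, hx⟩ := Fin.exists_succ_eq.2 (h j)
      simp [← hx, consRow_succ]
    rw [key, key r, key s, ← add_mul, hab, one_mul]

theorem isPreconnected_setOf_isTotallyPositive_consRow (M : Matrix (Fin n) (Fin k) ℝ) :
    IsPreconnected {r | IsTotallyPositive (consRow r M)} := by
  refine Convex.isPreconnected (E := Fin k → ℝ) fun r hr s hs a b ha hb hab g hg => ?_
  rw [det_consRow_submatrix_affine M hg.injective r s hab]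
  have h1 := hr g hg
  have h2 := hs g hg
  rcases ha.eq_or_lt with rfl | ha
  · rw [zero_add] at hab
    simpa [hab] using h2
  · exact add_pos_of_pos_of_nonneg (mul_pos ha h1) (mul_nonneg hb h2.le)

theorem isOpen_setOf_isTotallyPositive :
    IsOpen {M : Matrix (Fin n) (Fin k) ℝ | IsTotallyPositive M} := by
  simp only [IsTotallyPositive, Set.ofPred_forall]
  refine isOpen_iInter_of_finite fun g => isOpen_iInter_of_finite fun _ => ?_
  exact isOpen_lt continuous_const (continuous_id.matrix_submatrix g id).matrix_det

theorem isClosed_setOf_isTotallyNonneg :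
    IsClosed {M : Matrix (Fin n) (Fin k) ℝ | IsTotallyNonneg M} := by
  simp only [IsTotallyNonneg, Set.ofPred_forall]
  refine isClosed_iInter fun g => isClosed_iInter fun _ => ?_
  exact isClosed_le continuous_const (continuous_id.matrix_submatrix g id).matrix_det

theorem IsTotallyPositive.of_consRow {r : Fin k → ℝ} {M : Matrix (Fin n) (Fin k) ℝ}
    (h : IsTotallyPositive (consRow r M)) : IsTotallyPositive M :=
  fun g hg => h (Fin.succ ∘ g) ((Fin.strictMono_succ).comp hg)

theorem isTotallyPositive_square_iff {M : Matrix (Fin k) (Fin k) ℝ} :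
    IsTotallyPositive M ↔ 0 < M.det := by
  constructor
  · intro h
    simpa using h id strictMono_id
  · intro h g hg
    have : g = id := (hg.range_inj strictMono_id).1 (by
      rw [(Finite.injective_iff_surjective.1 hg.injective).range_eq, Set.range_id])
    simpa [this] using h

theorem eventually_sum_mul_pow_pos {c : Fin m → ℝ} {i : Fin m} (h0 : ∀ j < i, c j = 0)
    (hi : 0 < c i) : ∀ᶠ ε in 𝓝[>] (0 : ℝ), 0 < ∑ j, c j * ε ^ (j : ℕ) := by
  have hcont : Continuous fun ε : ℝ => ∑ j, c j * ε ^ ((j : ℕ) - (i : ℕ)) := by fun_prop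
  have hval : ∑ j, c j * (0 : ℝ) ^ ((j : ℕ) - (i : ℕ)) = c i := by
    rw [Finset.sum_eq_single i]
    · simp
    · intro j _ hj
      rcases lt_or_gt_of_ne hj with hlt | hgt
      · simp [h0 j hlt]
      · rw [zero_pow (Nat.sub_pos_of_lt hgt).ne', mul_zero]
    · simp
  have hev : ∀ᶠ ε in 𝓝 (0 : ℝ), 0 < ∑ j, c j * ε ^ ((j : ℕ) - (i : ℕ)) :=
    (hcont.tendsto 0).eventually (lt_mem_nhds (hval ▸ hi))
  filter_upwards [hev.filter_mono nhdsWithin_le_nhds, self_mem_nhdsWithin] with ε h1 h2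
  have : ∑ j, c j * ε ^ (j : ℕ) = ε ^ (i : ℕ) * ∑ j, c j * ε ^ ((j : ℕ) - (i : ℕ)) := by
    rw [Finset.mul_sum]
    refine Finset.sum_congr rfl fun j _ => ?_
    rcases lt_or_ge j i with hlt | hge
    · simp [h0 j hlt]
    · rw [mul_left_comm, ← pow_add, Nat.add_sub_cancel' hge]
  rw [this]
  exact mul_pos (pow_pos h2 _) h1

theorem Finset.neg_one_pow_card_filter_neg_mul_prod_pos {ι : Type*} (s : Finset ι) {f : ι → ℝ}
    (hf : ∀ i ∈ s, f i ≠ 0) : 0 < (-1 : ℝ) ^ (s.filter fun i => f i < 0).card * ∏ i ∈ s, f i := by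
  have h : (-1 : ℝ) ^ (s.filter fun i => f i < 0).card =
      ∏ i ∈ s, if f i < 0 then (-1 : ℝ) else 1 := by
    rw [Finset.prod_ite]; simp
  rw [h, ← Finset.prod_mul_distrib]
  refine Finset.prod_pos fun i hi => ?_
  split_ifs with h1
  · linarith
  · rw [one_mul]
    exact lt_of_le_of_ne (not_lt.1 h1) (hf i hi).symm

theorem indexVandermonde_cons (e : Fin m → Fin n) (x : Fin n) :
    indexVandermonde (Fin.cons x e : Fin (m + 1) → Fin n) =
      (∏ j, (((e j : ℕ) : ℝ) - (x : ℕ))) * indexVandermonde e := by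
  simp only [indexVandermonde, det_vandermonde]
  rw [Fin.prod_univ_succ]
  simp only [Fin.prod_Ioi_zero, Fin.prod_Ioi_succ, Fin.cons_zero, Fin.cons_succ]

/-- If `x` is the smallest index missed by `h`, then inserting row `x` in front of the rows `h`
produces a minor of sign `(-1) ^ x`. -/
theorem IsTotallyPositive.neg_one_pow_mul_det_cons_pos {M : Matrix (Fin n) (Fin (m + 1)) ℝ}
    (hM : IsTotallyPositive M) {h : Fin m → Fin n} (hh : StrictMono h) {x : Fin n}
    (hx : x ∉ Set.range h) (hlt : ∀ y < x, y ∈ Set.range h) :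
    0 < (-1 : ℝ) ^ (x : ℕ) *
      (M.submatrix (Fin.cons x h : Fin (m + 1) → Fin n) id).det := by
  have hinj : Function.Injective (Fin.cons x h : Fin (m + 1) → Fin n) :=
    Fin.cons_injective_iff.2 ⟨hx, hh.injective⟩
  have h1 := hM.det_mul_indexVandermonde_pos hinj
  rw [indexVandermonde_cons] at h1
  have hne : ∀ j ∈ Finset.univ, ((h j : ℕ) : ℝ) - (x : ℕ) ≠ 0 := by
    intro j _ h0
    refine hx ⟨j, Fin.ext ?_⟩
    exact_mod_cast sub_eq_zero.1 h0
  have h2 := Finset.neg_one_pow_card_filter_neg_mul_prod_pos Finset.univ hne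
  have hcard : (Finset.univ.filter fun j => ((h j : ℕ) : ℝ) - (x : ℕ) < 0).card = x := by
    rw [← Finset.card_image_of_injective _ hh.injective]
    refine Eq.trans (congrArg Finset.card ?_) (Fin.card_Iio x)
    ext y
    simp only [Finset.mem_image, Finset.mem_filter, Finset.mem_univ, true_and, Finset.mem_Iio,
      sub_neg, Nat.cast_lt, Fin.val_fin_lt]
    constructor
    · rintro ⟨j, hj, rfl⟩
      exact hj
    · intro hy
      obtain ⟨j, rfl⟩ := hlt y hy
      exact ⟨j, hy, rfl⟩
  rw [hcard] at h2
  have h3 := indexVandermonde_pos hh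
  rw [← mul_assoc] at h1
  have h4 := pos_of_mul_pos_left h1 h3.le
  have h5 : ((-1 : ℝ) ^ (x : ℕ)) * (-1 : ℝ) ^ (x : ℕ) = 1 := by
    rw [← mul_pow]; simp
  refine pos_of_mul_pos_left (b := (-1 : ℝ) ^ (x : ℕ) * ∏ j, (((h j : ℕ) : ℝ) - (x : ℕ))) ?_ h2.le
  rw [mul_mul_mul_comm, h5, one_mul]
  exact h4

theorem IsTotallyPositive.exists_consRow {M : Matrix (Fin n) (Fin (m + 1)) ℝ}
    (hM : IsTotallyPositive M) (hmn : m + 1 ≤ n) : ∃ r, IsTotallyPositive (consRow r M) := by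
  set r : ℝ → Fin (m + 1) → ℝ := fun ε =>
    ∑ j : Fin (m + 1), ((-1) ^ (j : ℕ) * ε ^ (j : ℕ)) • M (Fin.castLE hmn j)
  suffices h : ∀ᶠ ε in 𝓝[>] (0 : ℝ), IsTotallyPositive (consRow (r ε) M) from
    let ⟨ε, hε⟩ := h.exists; ⟨r ε, hε⟩
  simp only [IsTotallyPositive, eventually_all]
  intro g hg
  by_cases hg0 : g 0 = 0
  · obtain ⟨h, hh⟩ : ∃ h : Fin m → Fin n, ∀ i, g i.succ = (h i).succ := by
      have : ∀ i : Fin m, ∃ x : Fin n, g i.succ = x.succ := fun i => by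
        have hne : g i.succ ≠ 0 := by
          rw [← hg0]
          exact (hg (Fin.succ_pos i)).ne'
        obtain ⟨x, hx⟩ := Fin.exists_succ_eq.2 hne
        exact ⟨x, hx.symm⟩
      choose h hh using this
      exact ⟨h, hh⟩
    have hmono : StrictMono h := fun i j hij => by
      have := hg (Fin.succ_lt_succ_iff.2 hij)
      rwa [hh, hh, Fin.succ_lt_succ_iff] at this
    have hdet : ∀ s, ((consRow s M).submatrix g id).det =
        cramer ((consRow 0 M).submatrix g id)ᵀ s 0 := by
      intro s
      rw [cramer_transpose_apply]
      congr 1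
      ext i j
      refine Fin.cases ?_ (fun i => ?_) i
      · simp [hg0, consRow_zero]
      · simp [hh, consRow_succ, updateRow_apply]
    have hrow : ∀ x, cramer ((consRow 0 M).submatrix g id)ᵀ (M x) 0 =
        (M.submatrix (Fin.cons x h : Fin (m + 1) → Fin n) id).det := by
      intro x
      rw [← hdet]
      congr 1
      ext i j
      refine Fin.cases ?_ (fun i => ?_) i
      · simp [hg0, consRow_zero]
      · simp [hh, consRow_succ]
    have hsum : ∀ ε, ((consRow (r ε) M).submatrix g id).det = ∑ j : Fin (m + 1),
        ((-1) ^ (j : ℕ) * (M.submatrix (Fin.cons (Fin.castLE hmn j) h :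
          Fin (m + 1) → Fin n) id).det) * ε ^ (j : ℕ) := by
      intro ε
      simp only [hdet, r, map_sum, map_smul, Finset.sum_apply, Pi.smul_apply, hrow, smul_eq_mul]
      exact Finset.sum_congr rfl fun j _ => by ring
    obtain ⟨i, hi, hmin⟩ := WellFounded.has_min (wellFounded_lt (α := Fin (m + 1)))
      {j | Fin.castLE hmn j ∉ Set.range h} (by
        by_contra hcon
        rw [Set.not_nonempty_iff_eq_empty, Set.eq_empty_iff_forall_notMem] at hcon
        simp only [Set.mem_ofPred_eq, not_not] at hcon
        choose f hf using hcon
        have hfinj : Function.Injective f := fun a b hab => by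
          have := (hf a).symm.trans ((congrArg h hab).trans (hf b))
          exact Fin.castLE_injective hmn this
        simpa using Fintype.card_le_of_injective f hfinj)
    have hmin' : ∀ j < i, Fin.castLE hmn j ∈ Set.range h := fun j hj => by
      by_contra hcon
      exact hmin j hcon hj
    have hev := eventually_sum_mul_pow_pos (i := i) (c := fun j : Fin (m + 1) =>
      (-1) ^ (j : ℕ) * (M.submatrix (Fin.cons (Fin.castLE hmn j) h :
        Fin (m + 1) → Fin n) id).det) (fun j hj => by
          obtain ⟨l, hl⟩ := hmin' j hj
          rw [det_zero_of_row_eq (Fin.succ_ne_zero l).symm (by ext; simp [hl]), mul_zero])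
      (hM.neg_one_pow_mul_det_cons_pos hmono hi fun y hy => by
        have hy' : (y : ℕ) < i := hy
        exact hmin' ⟨y, hy'.trans i.2⟩ hy')
    filter_upwards [hev] with ε hε
    rwa [hsum]
  · refine Eventually.of_forall fun ε => ?_
    have : ∀ i, ∃ x : Fin n, x.succ = g i := fun i => by
      refine Fin.exists_succ_eq.2 ((Fin.pos_iff_ne_zero.2 hg0).trans_le ?_).ne'
      exact hg.monotone (Fin.zero_le i)
    choose h hh using this
    have hgh : g = Fin.succ ∘ h := funext fun i => (hh i).symm
    have hmono : StrictMono h := fun i j hij => by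
      have := hg hij
      rwa [← hh, ← hh, Fin.succ_lt_succ_iff] at this
    subst hgh
    exact hM h hmono

theorem isPreconnected_setOf_linearIndependent (hnk : n < k) :
    IsPreconnected {M : Matrix (Fin n) (Fin k) ℝ | LinearIndependent ℝ M.row} := by
  induction n with
  | zero => exact (Set.subsingleton_of_subsingleton).isPreconnected
  | succ n ih =>
    refine IsOpen.isPreconnected_of_consRow isOpen_setOfPred_linearIndependent (ih (by omega)) ?_ ?_ ?_
    · intro r M h
      exact (linearIndependent_finCons.1 h).1
    · intro M hM
      obtain ⟨r, hr⟩ := exists_linearIndependent_cons_of_lt_finrank hM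
        (by rw [Module.finrank_fin_fun]; omega)
      exact ⟨r, hr⟩
    · intro M hM
      have heq : {r | consRow r M ∈ {M | LinearIndependent ℝ M.row}} =
          ((Submodule.span ℝ (Set.range M.row) : Submodule ℝ (Fin k → ℝ)) :
            Set (Fin k → ℝ))ᶜ := by
        ext r
        exact linearIndependent_finCons.trans (and_iff_right hM)
      rw [heq]
      refine (isConnected_compl_of_one_lt_codim ?_).isPreconnected
      have h1 := Submodule.finrank_quotient_add_finrank
        (Submodule.span ℝ (Set.range M.row) : Submodule ℝ (Fin k → ℝ))
      rw [finrank_span_eq_card hM, Module.finrank_fin_fun, Fintype.card_fin] at h1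
      have h2 := Module.lt_rank_of_lt_finrank (R := ℝ) (n := 1)
        (M := (Fin k → ℝ) ⧸ (Submodule.span ℝ (Set.range M.row) : Submodule ℝ (Fin k → ℝ)))
        (by omega)
      simpa using h2

theorem isPreconnected_setOf_isTotallyPositive_square :
    IsPreconnected {M : Matrix (Fin (m + 1)) (Fin (m + 1)) ℝ | IsTotallyPositive M} := by
  refine isOpen_setOf_isTotallyPositive.isPreconnected_of_consRow
    (isPreconnected_setOf_linearIndependent m.lt_succ_self) ?_ ?_
    fun M _ => isPreconnected_setOf_isTotallyPositive_consRow M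
  · intro r M h
    have h1 : LinearIndependent ℝ (consRow r M).row :=
      linearIndependent_rows_iff_isUnit.2 ((isUnit_iff_isUnit_det _).2
        (isTotallyPositive_square_iff.1 h).ne'.isUnit)
    exact (linearIndependent_finCons.1 h1).1
  · intro M hM
    obtain ⟨r, hr⟩ := exists_linearIndependent_cons_of_lt_finrank hM
      (by rw [Module.finrank_fin_fun]; omega)
    have h1 : (consRow r M).det ≠ 0 :=
      ((isUnit_iff_isUnit_det _).1 (linearIndependent_rows_iff_isUnit.1 hr)).ne_zero
    rcases lt_or_gt_of_ne h1 with hneg | hpos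
    · refine ⟨-r, isTotallyPositive_square_iff.2 ?_⟩
      have h2 : consRow (-r) M = updateRow (consRow r M) 0 ((-1 : ℝ) • r) := by
        ext i j
        refine Fin.cases ?_ (fun i => ?_) i
        · simp [consRow_zero]
        · simp [consRow_succ, updateRow_apply]
      have h3 : updateRow (consRow r M) 0 r = consRow r M := updateRow_eq_self (consRow r M) 0
      rw [h2, det_updateRow_smul, h3]
      linarith
    · exact ⟨r, isTotallyPositive_square_iff.2 hpos⟩

theorem isPreconnected_setOf_isTotallyPositive (hmn : m + 1 ≤ n) :
    IsPreconnected {M : Matrix (Fin n) (Fin (m + 1)) ℝ | IsTotallyPositive M} := by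
  induction n, hmn using Nat.le_induction with
  | base => exact isPreconnected_setOf_isTotallyPositive_square
  | succ n hmn ih =>
    exact isOpen_setOf_isTotallyPositive.isPreconnected_of_consRow ih
      (fun _ _ h => h.of_consRow) (fun M hM => hM.exists_consRow hmn)
      fun M _ => isPreconnected_setOf_isTotallyPositive_consRow M

end Connectedness

section Subspaces

variable {N k : ℕ}

theorem mem_coordSubspace {S : Set (Fin N)} {x : Fin N → ℝ} :
    x ∈ coordSubspace N S ↔ ∀ i ∉ S, x i = 0 := by
  constructor
  · intro hx i hi
    have hle : coordSubspace N S ≤ LinearMap.ker (LinearMap.proj (R := ℝ) (φ := fun _ => ℝ) i) := by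
      refine Submodule.span_le.2 ?_
      rintro _ ⟨j, hj, rfl⟩
      have : i ≠ j := fun h => hi (h ▸ hj)
      simp [this]
    exact hle hx
  · intro h
    rw [pi_eq_sum_univ' x]
    refine Submodule.sum_mem _ fun i _ => ?_
    by_cases hi : i ∈ S
    · refine Submodule.smul_mem _ _ (Submodule.subset_span ⟨i, hi, ?_⟩)
      ext j; simp [Pi.single_apply, eq_comm]
    · simp [h i hi]

theorem inf_coordSubspace_eq_bot_iff {E : Submodule ℝ (Fin N → ℝ)} {S : Set (Fin N)} :
    E ⊓ coordSubspace N S = ⊥ ↔ ∀ x ∈ E, (∀ i ∉ S, x i = 0) → x = 0 := by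
  simp only [Submodule.eq_bot_iff, Submodule.mem_inf, mem_coordSubspace, and_imp]

theorem inf_coordSubspace_inf_coordSubspace (E : Submodule ℝ (Fin N → ℝ)) (A B : Set (Fin N)) :
    (E ⊓ coordSubspace N A) ⊓ (E ⊓ coordSubspace N B) = E ⊓ coordSubspace N (A ∩ B) := by
  ext x
  simp only [Submodule.mem_inf, mem_coordSubspace, Set.mem_inter_iff, not_and_or]
  grind

theorem sup_coordSubspace_inf_eq_iff {E : Submodule ℝ (Fin N → ℝ)} {A B : Set (Fin N)}
    (hAB : Disjoint A B) (hA : E ⊓ coordSubspace N A = ⊥) (hB : E ⊓ coordSubspace N B = ⊥) :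
    (E ⊔ coordSubspace N A) ⊓ (E ⊔ coordSubspace N B) = E ↔
      E ⊓ coordSubspace N (A ∪ B) = ⊥ := by
  classical
  rw [inf_coordSubspace_eq_bot_iff] at hA hB ⊢
  rw [Set.disjoint_left] at hAB
  constructor
  · intro h x hxE hx
    set u : Fin N → ℝ := fun i => if i ∈ A then x i else 0 with hu
    have huA : u ∈ coordSubspace N A := mem_coordSubspace.2 fun i hi => by simp [hu, hi]
    have hwB : x - u ∈ coordSubspace N B := mem_coordSubspace.2 fun i hi => by
      by_cases hiA : i ∈ A
      · simp [hu, hiA]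
      · simp [hu, hiA, hx i (by simp [hi, hiA])]
    have hwE : x - u ∈ E := by
      rw [← h]
      exact ⟨Submodule.sub_mem _ (Submodule.mem_sup_left hxE) (Submodule.mem_sup_right huA),
        Submodule.mem_sup_right hwB⟩
    have hxu : x = u := sub_eq_zero.1 (hB _ hwE (mem_coordSubspace.1 hwB))
    exact hA x hxE (mem_coordSubspace.1 (hxu ▸ huA))
  · intro h
    refine le_antisymm ?_ (le_inf le_sup_left le_sup_left)
    rintro y ⟨h1, h2⟩
    obtain ⟨e, he, u, hu, hy⟩ := Submodule.mem_sup.1 h1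
    obtain ⟨e', he', w, hw, hy'⟩ := Submodule.mem_sup.1 h2
    rw [mem_coordSubspace] at hu hw
    have hsub : e - e' = w - u := by
      rw [sub_eq_sub_iff_add_eq_add, hy, add_comm, hy']
    have h0 : e - e' = 0 := h _ (E.sub_mem he he') fun i hi => by
      rw [Set.mem_union, not_or] at hi
      rw [hsub]
      simp [hu i hi.1, hw i hi.2]
    have huw : w = u := sub_eq_zero.1 (hsub ▸ h0)
    have hu0 : u = 0 := by
      ext i
      by_cases hi : i ∈ A
      · rw [← huw]
        exact hw i (hAB hi)
      · exact hu i hi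
    rw [← hy, hu0, add_zero]
    exact he

/-- Genericity amounts to transversality to the coordinate subspaces complementary to the cyclic
intervals of length `k`. -/
theorem isGeneric_iff (hk : 1 ≤ k) (hkN : k < N) (E : Submodule ℝ (Fin N → ℝ)) :
    IsGeneric N k E ↔
      ∀ s < N, E ⊓ coordSubspace N {j | (j : ℕ) ∉ cyclicInterval N k s} = ⊥ := by
  have hfirst : {j : Fin N | (j : ℕ) ∉ cyclicInterval N k (N - k)} = {j : Fin N | (j : ℕ) < N - k} := by
    ext j
    have := j.2
    simp only [mem_cyclicInterval, Set.mem_ofPred_eq]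
    omega
  have hlast : {j : Fin N | (j : ℕ) ∉ cyclicInterval N k 0} = {j : Fin N | k ≤ (j : ℕ)} := by
    ext j
    have := j.2
    simp only [mem_cyclicInterval, Set.mem_ofPred_eq]
    omega
  have hwrap : ∀ i, 1 ≤ i → i ≤ k - 1 →
      {j : Fin N | k - i ≤ (j : ℕ)} ∩ {j | (j : ℕ) < N - i} =
        {j : Fin N | (j : ℕ) ∉ cyclicInterval N k (N - i)} := by
    intro i hi hik
    ext j
    have := j.2
    simp only [mem_cyclicInterval, Set.mem_ofPred_eq, Set.mem_inter_iff]
    omega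
  have hmid : ∀ i, 1 ≤ i → i ≤ N - k - 1 →
      {j : Fin N | N - i ≤ (j : ℕ)} ∪ {j | (j : ℕ) < N - k - i} =
        {j : Fin N | (j : ℕ) ∉ cyclicInterval N k (N - k - i)} := by
    intro i hi hik
    ext j
    have := j.2
    simp only [mem_cyclicInterval, Set.mem_ofPred_eq, Set.mem_union]
    omega
  have hsup : ∀ i, 1 ≤ i → i ≤ N - k - 1 →
      E ⊓ coordSubspace N {j : Fin N | (j : ℕ) < N - k} = ⊥ →
      E ⊓ coordSubspace N {j : Fin N | k ≤ (j : ℕ)} = ⊥ →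
      ((E ⊔ coordSubspace N {j : Fin N | N - i ≤ (j : ℕ)}) ⊓
          (E ⊔ coordSubspace N {j : Fin N | (j : ℕ) < N - k - i}) = E ↔
        E ⊓ coordSubspace N {j | (j : ℕ) ∉ cyclicInterval N k (N - k - i)} = ⊥) := by
    intro i hi hik h1 h2
    rw [inf_coordSubspace_eq_bot_iff] at h1 h2
    rw [sup_coordSubspace_inf_eq_iff, hmid i hi hik]
    · rw [Set.disjoint_left]
      intro j
      simp only [Set.mem_ofPred_eq]
      omega
    · refine inf_coordSubspace_eq_bot_iff.2 fun x hx h => h2 x hx fun j hj => h j ?_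
      simp only [Set.mem_ofPred_eq] at hj ⊢
      omega
    · refine inf_coordSubspace_eq_bot_iff.2 fun x hx h => h1 x hx fun j hj => h j ?_
      simp only [Set.mem_ofPred_eq] at hj ⊢
      omega
  simp only [IsGeneric, inf_coordSubspace_inf_coordSubspace]
  constructor
  · rintro ⟨h1, h2, h3, h4⟩ s hs
    rcases Nat.eq_zero_or_pos s with rfl | hs0
    · rwa [hlast]
    rcases lt_trichotomy s (N - k) with hlt | rfl | hgt
    · have := (hsup (N - k - s) (by omega) (by omega) h1 h2).1 (h4 _ (by omega) (by omega))
      rwa [show N - k - (N - k - s) = s by omega] at this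
    · rwa [hfirst]
    · have := h3 (N - s) (by omega) (by omega)
      rwa [hwrap (N - s) (by omega) (by omega), show N - (N - s) = s by omega] at this
  · intro h
    have h1 := hfirst ▸ h (N - k) (by omega)
    have h2 := hlast ▸ h 0 (by omega)
    refine ⟨h1, h2, fun i hi hik => ?_, fun i hi hik => ?_⟩
    · rw [hwrap i hi hik]
      exact h _ (by omega)
    · exact (hsup i hi hik h1 h2).2 (h _ (by omega))

theorem mem_colSpan {M : Matrix (Fin N) (Fin k) ℝ} {x : Fin N → ℝ} :
    x ∈ colSpan M ↔ ∃ c, M *ᵥ c = x := by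
  have : colSpan M = LinearMap.range M.mulVecLin := (range_mulVecLin M).symm
  rw [this]
  rfl

theorem rank_eq_iff_injective {M : Matrix (Fin N) (Fin k) ℝ} :
    M.rank = k ↔ ∀ c, M *ᵥ c = 0 → c = 0 := by
  have h := LinearMap.finrank_range_add_finrank_ker M.mulVecLin
  rw [Module.finrank_fin_fun] at h
  have h' : M.rank = k ↔ Module.finrank ℝ (LinearMap.ker M.mulVecLin) = 0 := by
    rw [Matrix.rank]
    omega
  rw [h', Submodule.finrank_eq_zero, Submodule.eq_bot_iff]
  rfl

/-- The minor on the rows `f` is nonzero iff the matrix has full rank and its column span is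
transversal to the complementary coordinate subspace. -/
theorem det_submatrix_ne_zero_iff {M : Matrix (Fin N) (Fin k) ℝ} {f : Fin k → Fin N}
    {S : Set (Fin N)} (hS : ∀ i, i ∉ S ↔ i ∈ Set.range f) :
    (M.submatrix f id).det ≠ 0 ↔ M.rank = k ∧ colSpan M ⊓ coordSubspace N S = ⊥ := by
  rw [← not_iff_not, not_not, ← exists_mulVec_eq_zero_iff, rank_eq_iff_injective,
    inf_coordSubspace_eq_bot_iff]
  have hsub : ∀ c i, (M.submatrix f id *ᵥ c) i = (M *ᵥ c) (f i) := fun c i => rfl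
  constructor
  · rintro ⟨c, hc, h⟩ ⟨h1, h2⟩
    refine hc (h1 c (h2 _ (mem_colSpan.2 ⟨c, rfl⟩) fun i hi => ?_))
    obtain ⟨j, rfl⟩ := (hS i).1 hi
    rw [← hsub, h]
    rfl
  · intro h
    by_contra! hcon
    have hinj : ∀ c, (∀ i, (M *ᵥ c) (f i) = 0) → c = 0 := fun c hc => by
      by_contra hc0
      exact hcon c hc0 (funext hc)
    refine h ⟨fun c hc => hinj c fun i => by rw [hc]; rfl, fun x hx hxS => ?_⟩
    obtain ⟨c, rfl⟩ := mem_colSpan.1 hx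
    rw [hinj c fun i => hxS _ ((hS _).2 ⟨i, rfl⟩), mulVec_zero]

end Subspaces

section Component

variable {N k : ℕ}

theorem IsTotallyNonneg.crossingClosed {M : Matrix (Fin N) (Fin k) ℝ} (hM : IsTotallyNonneg M) :
    CrossingClosed N k fun J => ∀ f : Fin k → Fin N,
      Finset.univ.image (fun i => (f i : ℕ)) = J → (M.submatrix f id).det ≠ 0 := by
  intro S a b c d hS hk hab hbc hcd hd ha hb hc hd' hyp
  obtain ⟨m, hm⟩ : ∃ m, S.card = m := ⟨_, rfl⟩
  rw [hm] at hk
  subst hk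
  set e : Fin m → Fin N := fun i =>
    ⟨S.orderEmbOfFin hm i, Finset.mem_range.1 (hS (Finset.orderEmbOfFin_mem S hm i))⟩
  have himage : ∀ x y : Fin N, Finset.univ.image
      (fun i => ((Fin.cons x (Fin.cons y e) : Fin (m + 2) → Fin N) i : ℕ)) =
        insert (x : ℕ) (insert (y : ℕ) S) := by
    intro x y
    have hSe : ∀ z, z ∈ S ↔ ∃ i, (e i : ℕ) = z := fun z => by
      rw [← Finset.mem_coe, ← Finset.range_orderEmbOfFin S hm]
      rfl
    ext z
    simp only [Finset.mem_image, Finset.mem_univ, true_and, Finset.mem_insert, hSe,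
      Fin.exists_fin_succ, Fin.cons_zero, Fin.cons_succ, eq_comm (a := z)]
  have hcross := hM.det_cons_cons_ne_zero e (a := ⟨a, by omega⟩) (b := ⟨b, by omega⟩)
    (c := ⟨c, by omega⟩) (d := ⟨d, hd⟩) hab hbc hcd
    (hyp.imp (fun h => ⟨h.1 _ (himage _ _), h.2 _ (himage _ _)⟩)
      fun h => ⟨h.1 _ (himage _ _), h.2 _ (himage _ _)⟩)
  have hfinish : ∀ x y : Fin N,
      (M.submatrix (Fin.cons x (Fin.cons y e) : Fin (m + 2) → Fin N) id).det ≠ 0 →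
      ∀ f : Fin (m + 2) → Fin N,
        Finset.univ.image (fun i => (f i : ℕ)) = insert (x : ℕ) (insert (y : ℕ) S) →
        (M.submatrix f id).det ≠ 0 := by
    intro x y hxy f hf
    rw [← himage x y] at hf
    have hrange : Set.range (Fin.cons x (Fin.cons y e) : Fin (m + 2) → Fin N) = Set.range f := by
      ext z
      have := Finset.ext_iff.1 hf (z : ℕ)
      simp only [Finset.mem_image, Finset.mem_univ, true_and, Fin.val_inj] at this
      exact this.symm
    refine det_submatrix_ne_zero_of_range_eq hxy ?_ hrange
    have hinj := Fin.val_injective.comp (injective_of_det_submatrix_ne_zero hxy)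
    have hcard : (Finset.univ.image fun i => (f i : ℕ)).card =
        (Finset.univ : Finset (Fin (m + 2))).card := by
      rw [hf]
      exact Finset.card_image_of_injective _ hinj
    have := Finset.card_image_iff.1 hcard
    intro i j hij
    exact this (Finset.mem_coe.2 (Finset.mem_univ i)) (Finset.mem_coe.2 (Finset.mem_univ j))
      (congrArg Fin.val hij)
  exact ⟨hfinish _ _ hcross.1, hfinish _ _ hcross.2⟩

theorem IsTotallyNonneg.isTotallyPositive_of_isGeneric {M : Matrix (Fin N) (Fin k) ℝ}
    (hM : IsTotallyNonneg M) (hk : 1 ≤ k) (hkN : k < N) (hrank : M.rank = k)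
    (hgen : IsGeneric N k (colSpan M)) : IsTotallyPositive M := by
  rw [isGeneric_iff hk hkN] at hgen
  intro g hg
  refine (hM g hg).lt_of_ne' ?_
  refine hM.crossingClosed.of_cyclicInterval hk hkN.le (fun s hs f hf => ?_) ?_ ?_ g rfl
  · refine (det_submatrix_ne_zero_iff fun i => ?_).2 ⟨hrank, hgen s hs⟩
    rw [← hf]
    simp [Fin.val_inj]
  · intro x hx
    obtain ⟨i, -, rfl⟩ := Finset.mem_image.1 hx
    exact Finset.mem_range.2 (g i).2
  · exact (Finset.card_image_of_injective _ (Fin.val_injective.comp hg.injective)).trans (by simp)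

theorem IsTotallyPositive.rank_eq_and_isGeneric {M : Matrix (Fin N) (Fin k) ℝ}
    (hM : IsTotallyPositive M) (hk : 1 ≤ k) (hkN : k < N) :
    M.rank = k ∧ IsGeneric N k (colSpan M) := by
  have key : ∀ s < N, M.rank = k ∧
      colSpan M ⊓ coordSubspace N {j | (j : ℕ) ∉ cyclicInterval N k s} = ⊥ := by
    intro s hs
    set f : Fin k → Fin N := fun i =>
      ⟨if s + i < N then s + i else s + i - N, by have := i.2; split_ifs <;> omega⟩ with hf
    have hfval : ∀ i, (f i : ℕ) = if s + i < N then s + i else s + i - N := fun i => rfl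
    have hinj : Function.Injective f := fun i j hij => by
      have h1 := congrArg Fin.val hij
      rw [hfval, hfval] at h1
      have := i.2
      have := j.2
      ext
      split_ifs at h1 <;> omega
    refine (det_submatrix_ne_zero_iff (f := f) fun i => ?_).1
      (left_ne_zero_of_mul (hM.det_mul_indexVandermonde_pos hinj).ne')
    simp only [Set.mem_ofPred_eq, not_not, mem_cyclicInterval, Set.mem_range, Fin.ext_iff, hfval]
    have hi := i.2
    constructor
    · rintro ⟨-, h | h⟩
      · exact ⟨⟨i - s, by omega⟩, by simp only; split_ifs <;> omega⟩
      · exact ⟨⟨i + N - s, by omega⟩, by simp only; split_ifs <;> omega⟩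
    · rintro ⟨j, hj⟩
      have := j.2
      split_ifs at hj <;> omega
  exact ⟨(key 0 (by omega)).1, (isGeneric_iff hk hkN _).2 fun s hs => (key s hs).2⟩

theorem forall_maxMinor_pos_iff {M : Matrix (Fin N) (Fin k) ℝ} :
    (∀ (I : Finset (Fin N)) (hI : I.card = k), 0 < maxMinor M I hI) ↔ IsTotallyPositive M := by
  constructor
  · intro h g hg
    have hI : (Finset.univ.image g).card = k := by
      rw [Finset.card_image_of_injective _ hg.injective]; simp
    have hgI := Finset.orderEmbOfFin_unique hI
      (fun i => Finset.mem_image_of_mem g (Finset.mem_univ i)) hg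
    change 0 < (M.submatrix (fun i => g i) id).det
    rw [hgI]
    exact h _ hI
  · intro h I hI
    exact h (I.orderEmbOfFin hI) (I.orderEmbOfFin hI).strictMono

theorem isTotallyPositive_rectVandermonde :
    IsTotallyPositive (of fun (i : Fin N) (j : Fin k) => ((i : ℕ) : ℝ) ^ (j : ℕ)) :=
  fun _ hg => indexVandermonde_pos hg

end Component

/-- The set `P` of `N×k` matrices with all maximal minors positive is a connected component of
the set `G` of `N×k` matrices of rank `k` whose column span is generic: `P` is nonempty and it
equals the connected component in `G` of each of its points. -/
theorem stmt12 (N k : ℕ) (hN : 2 ≤ N) (hk1 : 1 ≤ k) (hk2 : k ≤ N - 1) :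
    ({M : Matrix (Fin N) (Fin k) ℝ |
        ∀ (I : Finset (Fin N)) (hI : I.card = k), 0 < maxMinor M I hI} : Set _).Nonempty ∧
    ∀ M : Matrix (Fin N) (Fin k) ℝ,
      (∀ (I : Finset (Fin N)) (hI : I.card = k), 0 < maxMinor M I hI) →
      connectedComponentIn
          {M' : Matrix (Fin N) (Fin k) ℝ | M'.rank = k ∧ IsGeneric N k (colSpan M')} M
        = {M' : Matrix (Fin N) (Fin k) ℝ |
            ∀ (I : Finset (Fin N)) (hI : I.card = k), 0 < maxMinor M' I hI} := by
  have hkN : k < N := by omega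
  simp only [forall_maxMinor_pos_iff]
  refine ⟨⟨_, isTotallyPositive_rectVandermonde⟩, fun M hM => ?_⟩
  refine Set.Subset.antisymm ?_ ?_
  · refine isPreconnected_connectedComponentIn.subset_of_closure_inter_subset
      isOpen_setOf_isTotallyPositive
      ⟨M, mem_connectedComponentIn (hM.rank_eq_and_isGeneric hk1 hkN), hM⟩ ?_
    rintro M' ⟨hcl, hM'⟩
    have hnonneg : IsTotallyNonneg M' :=
      closure_minimal (fun A (hA : IsTotallyPositive A) g hg => (hA g hg).le)
        isClosed_setOf_isTotallyNonneg hcl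
    obtain ⟨hrank, hgen⟩ := connectedComponentIn_subset _ _ hM'
    exact hnonneg.isTotallyPositive_of_isGeneric hk1 hkN hrank hgen
  · obtain ⟨m, rfl⟩ : ∃ m, k = m + 1 := ⟨k - 1, by omega⟩
    exact (isPreconnected_setOf_isTotallyPositive hkN.le).subset_connectedComponentIn hM
      fun A hA => hA.rank_eq_and_isGeneric hk1 hkN
end
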